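/- arXiv:0903.1554 — 4 statements merged into one kernel-verified Lean document; each statement's English description precedes it below -/
import Mathlib

section
/- Let K be a field and V a K-vector space. With the operations defined on T_↗(V), the following five identities hold for all u, v, w ∈ T_↗(V): (u ↗ v) ↗ w = u ↗ (v ↗ w); (u·v)·w = u·(v·w); (u ↗ v)·w = u ↗ (v·w); (u·v) ↗ w = 0; and u·(v ↗ w) = 0. (That is, T_↗(V) is an algebra over the Koszul dual operad P_↗^!.) -/
open scoped TensorProduct DirectSum

noncomputable section

variable (K : Type*) [Field K] (V : Type*) [AddCommGroup V] [Module K V]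

/-- `n`-th tensor power of `V`. -/
abbrev TP (n : ℕ) : Type _ := ⨂[K]^n V

/-- Cast between tensor powers along an equality of exponents. -/
def castE {a b : ℕ} (h : a = b) : TP K V a ≃ₗ[K] TP K V b :=
  PiTensorProduct.reindex K (fun _ => V) (finCongr h)

/-- Concatenation of tensor powers. -/
def mulE (a b : ℕ) : (TP K V a ⊗[K] TP K V b) ≃ₗ[K] TP K V (a + b) :=
  (PiTensorProduct.tmulEquiv K V).trans
    (PiTensorProduct.reindex K (fun _ => V) finSumFinEquiv)

/-- `V^{⊗1} ≅ V`. -/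
def oneE : TP K V 1 ≃ₗ[K] V := PiTensorProduct.subsingletonEquiv (0 : Fin 1)

/-- The space `T(V) = ⊕_{n ≥ 1} ⊕_{k=1}^{n} V^{⊗ n}`; the summand indexed by
`(a, b) : ℕ × ℕ` is the copy of `V^{⊗ (a+1+b)}` whose point (resp. mark count) is at
(1-indexed) position `a + 1`, i.e. `a` letters before the pointed one, `b` after. -/
abbrev TT : Type _ := ⨁ (p : ℕ × ℕ), TP K V (p.1 + 1 + p.2)

/-- Assemble a bilinear map on `TT` from componentwise bilinear maps. -/
def liftBil
    (comp : ∀ i j : ℕ × ℕ,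
      TP K V (i.1 + 1 + i.2) →ₗ[K] TP K V (j.1 + 1 + j.2) →ₗ[K] TT K V) :
    TT K V →ₗ[K] TT K V →ₗ[K] TT K V :=
  DirectSum.toModule K _ _ fun i =>
    (DirectSum.toModule K _ _ fun j => (comp i j).flip).flip

/-- Concatenation of tensor powers as a bilinear map. -/
def concatB (a b : ℕ) : TP K V a →ₗ[K] TP K V b →ₗ[K] TP K V (a + b) :=
  (TensorProduct.mk K (TP K V a) (TP K V b)).compr₂ (mulE K V a b).toLinearMap

/-- The product `m` of `T_↗(V)`: `v · w` vanishes unless `w` has no marked tensor signs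
(`j.1 = 0`), in which case the words are concatenated, keeping the marks of `v`. -/
def mComp (i j : ℕ × ℕ) :
    TP K V (i.1 + 1 + i.2) →ₗ[K] TP K V (j.1 + 1 + j.2) →ₗ[K] TT K V :=
  if h : j.1 = 0 then
    (concatB K V _ _).compr₂
      ((DirectSum.lof K (ℕ × ℕ) (fun p => TP K V (p.1 + 1 + p.2)) (i.1, i.2 + 1 + j.2)) ∘ₗ
        (castE K V (show (i.1 + 1 + i.2) + (j.1 + 1 + j.2) = i.1 + 1 + (i.2 + 1 + j.2) by
          omega)).toLinearMap)
  else 0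

/-- The product `↗` of `T_↗(V)`: `v ↗ w` vanishes unless all tensor signs of `v` are
marked (`i.2 = 0`), in which case the words are concatenated, all the tensor signs coming
from `v` being marked, and the marks of `w` kept. -/
def nComp (i j : ℕ × ℕ) :
    TP K V (i.1 + 1 + i.2) →ₗ[K] TP K V (j.1 + 1 + j.2) →ₗ[K] TT K V :=
  if h : i.2 = 0 then
    (concatB K V _ _).compr₂
      ((DirectSum.lof K (ℕ × ℕ) (fun p => TP K V (p.1 + 1 + p.2)) (i.1 + 1 + j.1, j.2)) ∘ₗ
        (castE K V (show (i.1 + 1 + i.2) + (j.1 + 1 + j.2) = (i.1 + 1 + j.1) + 1 + j.2 by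
          omega)).toLinearMap)
  else 0

/-- The product `m` of `T_↗(V)` on the whole space. -/
def Tmul : TT K V →ₗ[K] TT K V →ₗ[K] TT K V := liftBil K V (mComp K V)

/-- The product `↗` of `T_↗(V)` on the whole space. -/
def Tnea : TT K V →ₗ[K] TT K V →ₗ[K] TT K V := liftBil K V (nComp K V)

/-- The word `f 0 ⊗ … ⊗ f (a + b)` with its first `a` tensor signs marked. -/
def markedWord (a b : ℕ) (f : ℕ → V) : TT K V :=
  DirectSum.lof K (ℕ × ℕ) (fun p => TP K V (p.1 + 1 + p.2)) (a, b)
    (PiTensorProduct.tprod K fun k => f k)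

/-- Concatenation of the first `n` letters of `f` with `g`. -/
def appendSeq {V : Type*} (n : ℕ) (f g : ℕ → V) (k : ℕ) : V :=
  if k < n then f k else g (k - n)

theorem appendSeq_assoc {V : Type*} (m n : ℕ) (f g h : ℕ → V) :
    appendSeq (m + n) (appendSeq m f g) h = appendSeq m f (appendSeq n g h) := by
  funext k
  unfold appendSeq
  split_ifs <;> first | rfl | omega | (congr 1; omega)

variable {K V}

theorem markedWord_induction {p : TT K V → Prop} (word : ∀ a b f, p (markedWord K V a b f))
    (add : ∀ x y, p x → p y → p (x + y)) (smul : ∀ (r : K) x, p x → p (r • x))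
    (x : TT K V) : p x := by
  induction x using DirectSum.induction_on with
  | zero => simpa using smul 0 _ (word 0 0 0)
  | of i x =>
    induction x using PiTensorProduct.induction_on with
    | smul_tprod r f =>
      have hword := smul r _ (word i.1 i.2 fun k => if h : k < i.1 + 1 + i.2 then f ⟨k, h⟩ else 0)
      rw [markedWord, ← map_smul] at hword
      simp only [Fin.is_lt, dite_true, Fin.eta] at hword
      exact hword
    | add x y hx hy => simpa using add _ _ hx hy
  | add x y hx hy => exact add x y hx hy

theorem castE_concatB_tprod {a b c : ℕ} (h : a + b = c) (f g : ℕ → V) :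
    castE K V h (concatB K V a b (PiTensorProduct.tprod K fun k => f k)
      (PiTensorProduct.tprod K fun k => g k)) =
    PiTensorProduct.tprod K fun k : Fin c => appendSeq a f g k := by
  subst h
  simp only [castE, concatB, mulE, LinearMap.compr₂_apply, TensorProduct.mk_apply,
    LinearEquiv.coe_coe, LinearEquiv.trans_apply, PiTensorProduct.tmulEquiv_apply,
    PiTensorProduct.reindex_tprod]
  congr 1
  funext k
  refine Fin.addCases (fun k => ?_) (fun k => ?_) k <;> simp [appendSeq]

theorem liftBil_lof
    (comp : ∀ i j : ℕ × ℕ,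
      TP K V (i.1 + 1 + i.2) →ₗ[K] TP K V (j.1 + 1 + j.2) →ₗ[K] TT K V)
    (i j : ℕ × ℕ) (x : TP K V (i.1 + 1 + i.2)) (y : TP K V (j.1 + 1 + j.2)) :
    liftBil K V comp (DirectSum.lof K (ℕ × ℕ) (fun p => TP K V (p.1 + 1 + p.2)) i x)
      (DirectSum.lof K (ℕ × ℕ) (fun p => TP K V (p.1 + 1 + p.2)) j y) = comp i j x y := by
  simp [liftBil, DirectSum.toModule_lof]

theorem Tmul_markedWord (a b c d : ℕ) (f g : ℕ → V) :
    Tmul K V (markedWord K V a b f) (markedWord K V c d g) =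
      if c = 0 then markedWord K V a (b + 1 + d) (appendSeq (a + 1 + b) f g) else 0 := by
  rw [Tmul, markedWord, markedWord, liftBil_lof, mComp]
  split_ifs
  · exact congrArg (DirectSum.lof K (ℕ × ℕ) (fun p => TP K V (p.1 + 1 + p.2)) (a, b + 1 + d))
      (castE_concatB_tprod (by dsimp only; omega) f g)
  · rfl

theorem Tnea_markedWord (a b c d : ℕ) (f g : ℕ → V) :
    Tnea K V (markedWord K V a b f) (markedWord K V c d g) =
      if b = 0 then markedWord K V (a + 1 + c) d (appendSeq (a + 1 + b) f g) else 0 := by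
  rw [Tnea, markedWord, markedWord, liftBil_lof, nComp]
  split_ifs
  · exact congrArg (DirectSum.lof K (ℕ × ℕ) (fun p => TP K V (p.1 + 1 + p.2)) (a + 1 + c, d))
      (castE_concatB_tprod (by dsimp only; omega) f g)
  · rfl

theorem Tnea_Tnea_markedWord (a b c d m n : ℕ) (f g h : ℕ → V) :
    Tnea K V (Tnea K V (markedWord K V a b f) (markedWord K V c d g)) (markedWord K V m n h) =
      Tnea K V (markedWord K V a b f)
        (Tnea K V (markedWord K V c d g) (markedWord K V m n h)) := by
  rcases eq_or_ne b 0 with rfl | hb <;> rcases eq_or_ne d 0 with rfl | hd <;>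
    simp [Tnea_markedWord, ← appendSeq_assoc, add_assoc, *]

theorem Tmul_Tmul_markedWord (a b c d m n : ℕ) (f g h : ℕ → V) :
    Tmul K V (Tmul K V (markedWord K V a b f) (markedWord K V c d g)) (markedWord K V m n h) =
      Tmul K V (markedWord K V a b f)
        (Tmul K V (markedWord K V c d g) (markedWord K V m n h)) := by
  rcases eq_or_ne c 0 with rfl | hc <;> rcases eq_or_ne m 0 with rfl | hm <;>
    simp [Tmul_markedWord, ← appendSeq_assoc, add_assoc, *]

theorem Tmul_Tnea_markedWord (a b c d m n : ℕ) (f g h : ℕ → V) :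
    Tmul K V (Tnea K V (markedWord K V a b f) (markedWord K V c d g)) (markedWord K V m n h) =
      Tnea K V (markedWord K V a b f)
        (Tmul K V (markedWord K V c d g) (markedWord K V m n h)) := by
  rcases eq_or_ne b 0 with rfl | hb <;> rcases eq_or_ne m 0 with rfl | hm <;>
    simp [Tmul_markedWord, Tnea_markedWord, ← appendSeq_assoc, add_assoc, *]

theorem Tnea_Tmul_markedWord (a b c d m n : ℕ) (f g h : ℕ → V) :
    Tnea K V (Tmul K V (markedWord K V a b f) (markedWord K V c d g))
      (markedWord K V m n h) = 0 := by
  rcases eq_or_ne c 0 with rfl | hc <;> simp [Tmul_markedWord, Tnea_markedWord, *]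

theorem Tmul_apply_Tnea_markedWord (a b c d m n : ℕ) (f g h : ℕ → V) :
    Tmul K V (markedWord K V a b f)
      (Tnea K V (markedWord K V c d g) (markedWord K V m n h)) = 0 := by
  rcases eq_or_ne d 0 with rfl | hd <;> simp [Tmul_markedWord, Tnea_markedWord, *]

variable (K V)

/-- `T_↗(V)`, with the concatenation product `m` and the product `↗`
defined above, satisfies the five defining identities of algebras over the Koszul dual
operad `P_↗^!`, for all `u v w : T_↗(V)`. -/
theorem Tup_is_Pdual_algebra (u v w : TT K V) :
    Tnea K V (Tnea K V u v) w = Tnea K V u (Tnea K V v w) ∧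
    Tmul K V (Tmul K V u v) w = Tmul K V u (Tmul K V v w) ∧
    Tmul K V (Tnea K V u v) w = Tnea K V u (Tmul K V v w) ∧
    Tnea K V (Tmul K V u v) w = 0 ∧
    Tmul K V u (Tnea K V v w) = 0 := by
  induction u using markedWord_induction with
  | add x y hx hy => simp only [map_add, LinearMap.add_apply, hx, hy, add_zero, and_self]
  | smul r x hx => simp only [map_smul, LinearMap.smul_apply, hx, smul_zero, and_self]
  | word a b f =>
  induction v using markedWord_induction with
  | add x y hx hy => simp only [map_add, LinearMap.add_apply, hx, hy, add_zero, and_self]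
  | smul r x hx => simp only [map_smul, LinearMap.smul_apply, hx, smul_zero, and_self]
  | word c d g =>
  induction w using markedWord_induction with
  | add x y hx hy => simp only [map_add, hx, hy, add_zero, and_self]
  | smul r x hx => simp only [map_smul, hx, smul_zero, and_self]
  | word m n h =>
  exact ⟨Tnea_Tnea_markedWord .., Tmul_Tmul_markedWord .., Tmul_Tnea_markedWord ..,
    Tnea_Tmul_markedWord .., Tmul_apply_Tnea_markedWord ..⟩
end
end

section
/- Let A be a K-vector space with two bilinear operations (a,b) ↦ ab and (a,b) ↦ a ↗ b, and let d be the map on C_* defined from these operations. Then for all v_1, v_2, v_3 ∈ A: d(d(v_1 ⊗ v_2 ⊗ v_3)) = (v_1v_2)v_3 − v_1(v_2v_3), d(d(v_1 ⊗̂ v_2 ⊗ v_3)) = (v_1 ↗ v_2)v_3 − v_1 ↗ (v_2v_3), and d(d(v_1 ⊗̂ v_2 ⊗̂ v_3)) = (v_1 ↗ v_2) ↗ v_3 − v_1 ↗ (v_2 ↗ v_3). Consequently d∘d vanishes on C_3 if and only if the three relations (ab)c = a(bc), (a↗b)c = a↗(bc) and (a↗b)↗c = a↗(b↗c) hold for all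 a, b, c ∈ A. -/
open scoped TensorProduct DirectSum

noncomputable section

variable (K : Type*) [Field K] (V : Type*) [AddCommGroup V] [Module K V]

variable (f g : V →ₗ[K] V →ₗ[K] V)

/-- The bilinear map `f` applied to `V^{⊗2}`. -/
def f2 : TP K V 2 →ₗ[K] V :=
  TensorProduct.lift f ∘ₗ
    TensorProduct.map (oneE K V).toLinearMap (oneE K V).toLinearMap ∘ₗ
    (mulE K V 1 1).symm.toLinearMap ∘ₗ (castE K V (show 2 = 1 + 1 by rfl)).toLinearMap

/-- The map `V^{⊗(p+2+q)} → V^{⊗(p+1+q)}` contracting the letters in positions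
`p+1, p+2` (1-indexed) by means of the bilinear operation `f`. -/
def mergeCore (p q : ℕ) : TP K V (p + (2 + q)) →ₗ[K] TP K V (p + (1 + q)) :=
  (mulE K V p (1 + q)).toLinearMap ∘ₗ
    TensorProduct.map LinearMap.id
      ((mulE K V 1 q).toLinearMap ∘ₗ
        TensorProduct.map ((oneE K V).symm.toLinearMap ∘ₗ f2 K V f) LinearMap.id ∘ₗ
        (mulE K V 2 q).symm.toLinearMap) ∘ₗ
    (mulE K V p (2 + q)).symm.toLinearMap

/-- The map `V^{⊗n} → V^{⊗(n-1)}` contracting the letters in positions `p+1, p+2`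
(1-indexed, `0 ≤ p ≤ n-2`) by means of the bilinear operation `f`. -/
def mergeAt (n p : ℕ) (h : p + 2 ≤ n) : TP K V n →ₗ[K] TP K V (n - 1) :=
  (castE K V (show p + (1 + (n - p - 2)) = n - 1 by omega)).toLinearMap ∘ₗ
    mergeCore K V f p (n - p - 2) ∘ₗ
    (castE K V (show n = p + (2 + (n - p - 2)) by omega)).toLinearMap
/-- The component on the summand of index `(a, b)` (word of length `n = a+1+b` whose
first `a` tensor signs are marked) of the differential of the complex computing the
homology of an algebra `(V, f, g)` with products `ab := f a b` and `a ↗ b := g a b`: the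
alternating sum over the `n-1` pairs of adjacent letters of the contractions, the pairs
joined by a marked tensor sign (0-indexed merge positions `p < a`) being contracted by
`↗` and the other ones by `f`; the number of marked signs decreases by one in the first
case and is unchanged in the second. -/
def dCompUp (a b : ℕ) : TP K V (a + 1 + b) →ₗ[K] TT K V :=
  ∑ p : Fin (a + 1 + b - 1),
    ((-1 : K) ^ (p : ℕ)) •
      (if hpa : (p : ℕ) < a then
        (DirectSum.lof K (ℕ × ℕ) (fun q => TP K V (q.1 + 1 + q.2)) (a - 1, b)) ∘ₗ
          (castE K V (show a + 1 + b - 1 = (a - 1) + 1 + b by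
            have := p.isLt; omega)).toLinearMap ∘ₗ
          mergeAt K V g (a + 1 + b) p (by have := p.isLt; omega)
      else
        (DirectSum.lof K (ℕ × ℕ) (fun q => TP K V (q.1 + 1 + q.2)) (a, b - 1)) ∘ₗ
          (castE K V (show a + 1 + b - 1 = a + 1 + (b - 1) by
            have := p.isLt; omega)).toLinearMap ∘ₗ
          mergeAt K V f (a + 1 + b) p (by have := p.isLt; omega))

/-- The differential `d` of the complex `C_*` associated with the algebra `(V, f, g)`
with products `ab := f a b` and `a ↗ b := g a b`. -/
def dUp : TT K V →ₗ[K] TT K V :=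
  DirectSum.toModule K (ℕ × ℕ) (TT K V) fun q => dCompUp K V f g q.1 q.2
/-- The inclusion of `V = C_1` into `C_*` as the summand of index `(0,0)`. -/
def iotaC : V →ₗ[K] TT K V :=
  (DirectSum.lof K (ℕ × ℕ) (fun p => TP K V (p.1 + 1 + p.2)) (0, 0)) ∘ₗ
    (oneE K V).symm.toLinearMap

/-- The summand `C_3` of the complex: the span of the components of index `(a,b)` with
`a + 1 + b = 3`. -/
def C3 : Submodule K (TT K V) :=
  ⨆ (p : ℕ × ℕ) (_ : p.1 + 1 + p.2 = 3),
    LinearMap.range (DirectSum.lof K (ℕ × ℕ) (fun q => TP K V (q.1 + 1 + q.2)) p)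

theorem castE_tprod {a b : ℕ} (h : a = b) (v : Fin a → V) :
    castE K V h (PiTensorProduct.tprod K v) =
      PiTensorProduct.tprod K fun i => v (Fin.cast h.symm i) :=
  PiTensorProduct.reindex_tprod _ _

theorem mulE_tmul_tprod (a b : ℕ) (v : Fin a → V) (w : Fin b → V) :
    mulE K V a b (PiTensorProduct.tprod K v ⊗ₜ[K] PiTensorProduct.tprod K w) =
      PiTensorProduct.tprod K (Fin.append v w) := by
  rw [mulE, LinearEquiv.trans_apply, PiTensorProduct.tmulEquiv_apply,
    PiTensorProduct.reindex_tprod]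
  congr 1
  ext i
  refine Fin.addCases (fun j => ?_) (fun j => ?_) i <;> simp

theorem mulE_symm_tprod (a b : ℕ) (v : Fin (a + b) → V) :
    (mulE K V a b).symm (PiTensorProduct.tprod K v) =
      PiTensorProduct.tprod K (fun i => v (Fin.castAdd b i)) ⊗ₜ[K]
        PiTensorProduct.tprod K (fun i => v (Fin.natAdd a i)) := by
  rw [LinearEquiv.symm_apply_eq, mulE_tmul_tprod, Fin.append_castAdd_natAdd]

theorem oneE_tprod (v : Fin 1 → V) : oneE K V (PiTensorProduct.tprod K v) = v 0 :=
  PiTensorProduct.subsingletonEquiv_apply_tprod _ _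

theorem oneE_symm_apply (x : V) :
    (oneE K V).symm x = PiTensorProduct.tprod K fun _ => x := by
  rw [LinearEquiv.symm_apply_eq, oneE_tprod]

theorem f2_tprod (v : Fin 2 → V) :
    f2 K V f (PiTensorProduct.tprod K v) = f (v 0) (v 1) := by
  simp only [f2, LinearMap.comp_apply, LinearEquiv.coe_coe, castE_tprod, mulE_symm_tprod,
    TensorProduct.map_tmul, oneE_tprod, TensorProduct.lift.tmul]
  rfl

theorem mergeCore_tprod (p q : ℕ) (v : Fin (p + (2 + q)) → V) :
    mergeCore K V f p q (PiTensorProduct.tprod K v) =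
      PiTensorProduct.tprod K (Fin.append (fun i => v (Fin.castAdd _ i))
        (Fin.append
          (fun _ => f (v (Fin.natAdd p (Fin.castAdd q 0))) (v (Fin.natAdd p (Fin.castAdd q 1))))
          (fun i => v (Fin.natAdd p (Fin.natAdd 2 i))))) := by
  simp only [mergeCore, LinearMap.comp_apply, LinearEquiv.coe_coe, mulE_symm_tprod,
    TensorProduct.map_tmul, LinearMap.id_apply, f2_tprod, oneE_symm_apply, mulE_tmul_tprod]

/-- Contracting the letters in positions `p` and `p + 1` (0-indexed) of a pure tensor. -/
theorem mergeAt_tprod (n p : ℕ) (h : p + 2 ≤ n) (v : Fin n → V) :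
    mergeAt K V f n p h (PiTensorProduct.tprod K v) =
      PiTensorProduct.tprod K fun i : Fin (n - 1) =>
        if (i : ℕ) < p then v ⟨i, by omega⟩
        else if (i : ℕ) = p then f (v ⟨p, by omega⟩) (v ⟨p + 1, by omega⟩)
        else v ⟨i + 1, by omega⟩ := by
  simp only [mergeAt, LinearMap.comp_apply, LinearEquiv.coe_coe, castE_tprod, mergeCore_tprod]
  congr 1
  ext i
  obtain ⟨j, rfl⟩ :
      ∃ j, Fin.cast (show p + (1 + (n - p - 2)) = n - 1 by omega) j = i :=
    ⟨Fin.cast (by omega) i, rfl⟩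
  rw [Fin.cast_cast, Fin.cast_eq_self]
  refine Fin.addCases (fun k => ?_) (fun k => ?_) j
  · rw [Fin.append_left]
    simp [Fin.cast, Fin.castAdd, Fin.castLE]
  · refine Fin.addCases (fun l => ?_) (fun l => ?_) k
    · obtain rfl := Subsingleton.elim l 0
      rw [Fin.append_right, Fin.append_left]
      simp [Fin.cast, Fin.castAdd, Fin.castLE, Fin.natAdd]
    · have h1 : ¬ p + (1 + (l : ℕ)) < p := by omega
      simp only [Fin.append_right, Fin.val_cast, Fin.val_natAdd, h1, if_false,
        show ¬ p + (1 + (l : ℕ)) = p by omega]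
      congr 1
      ext
      simp
      omega

theorem dUp_lof (q : ℕ × ℕ) (x : TP K V (q.1 + 1 + q.2)) :
    dUp K V f g (DirectSum.lof K (ℕ × ℕ) (fun q => TP K V (q.1 + 1 + q.2)) q x) =
      dCompUp K V f g q.1 q.2 x := by
  rw [dUp, DirectSum.toModule_lof]

/-- The word with letters `v`, viewed in the summand of `C_*` of index `(a, b)`. -/
def word (a b : ℕ) (v : Fin (a + 1 + b) → V) : TT K V :=
  DirectSum.lof K (ℕ × ℕ) (fun q => TP K V (q.1 + 1 + q.2)) (a, b) (PiTensorProduct.tprod K v)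

theorem dUp_word (a b : ℕ) (v : Fin (a + 1 + b) → V) :
    dUp K V f g (word K V a b v) =
      ∑ p : Fin (a + 1 + b - 1), ((-1 : K) ^ (p : ℕ)) •
        if _ : (p : ℕ) < a then
          word K V (a - 1) b fun i =>
            if (i : ℕ) < p then v ⟨i, by omega⟩
            else if (i : ℕ) = p then g (v ⟨p, by omega⟩) (v ⟨p + 1, by omega⟩)
            else v ⟨i + 1, by omega⟩
        else
          word K V a (b - 1) fun i =>
            if (i : ℕ) < p then v ⟨i, by omega⟩
            else if (i : ℕ) = p then f (v ⟨p, by omega⟩) (v ⟨p + 1, by omega⟩)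
            else v ⟨i + 1, by omega⟩ := by
  rw [word, dUp_lof, dCompUp, LinearMap.sum_apply]
  refine Finset.sum_congr rfl fun p _ => ?_
  rw [LinearMap.smul_apply]
  congr 1
  split_ifs with hp
  all_goals
    simp only [LinearMap.comp_apply, LinearEquiv.coe_coe, mergeAt_tprod, castE_tprod]
    rfl

theorem iotaC_eq_word (x : V) : iotaC K V x = word K V 0 0 fun _ => x := by
  rw [iotaC, LinearMap.comp_apply, LinearEquiv.coe_coe, oneE_symm_apply]
  rfl

theorem dUp_word_zero_one (x y : V) :
    dUp K V f g (word K V 0 1 ![x, y]) = iotaC K V (f x y) := by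
  rw [dUp_word, iotaC_eq_word]
  refine (Fin.sum_univ_one _).trans ?_
  simp

theorem dUp_word_one_zero (x y : V) :
    dUp K V f g (word K V 1 0 ![x, y]) = iotaC K V (g x y) := by
  rw [dUp_word, iotaC_eq_word]
  refine (Fin.sum_univ_one _).trans ?_
  simp

theorem dUp_word_zero_two (x y z : V) :
    dUp K V f g (word K V 0 2 ![x, y, z]) =
      word K V 0 1 ![f x y, z] - word K V 0 1 ![x, f y z] := by
  rw [dUp_word]
  refine (Fin.sum_univ_two _).trans ?_
  simp [sub_eq_add_neg]
  congr 3
  all_goals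
    ext i
    fin_cases i <;> rfl

theorem dUp_word_one_one (x y z : V) :
    dUp K V f g (word K V 1 1 ![x, y, z]) =
      word K V 0 1 ![g x y, z] - word K V 1 0 ![x, f y z] := by
  rw [dUp_word]
  refine (Fin.sum_univ_two _).trans ?_
  simp [sub_eq_add_neg]
  congr 3
  all_goals
    ext i
    fin_cases i <;> rfl

theorem dUp_word_two_zero (x y z : V) :
    dUp K V f g (word K V 2 0 ![x, y, z]) =
      word K V 1 0 ![g x y, z] - word K V 1 0 ![x, g y z] := by
  rw [dUp_word]
  refine (Fin.sum_univ_two _).trans ?_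
  simp [sub_eq_add_neg]
  congr 3
  all_goals
    ext i
    fin_cases i <;> rfl

theorem dUp_dUp_word_zero_two (x y z : V) :
    dUp K V f g (dUp K V f g (word K V 0 2 ![x, y, z])) =
      iotaC K V (f (f x y) z - f x (f y z)) := by
  rw [dUp_word_zero_two, map_sub, map_sub, dUp_word_zero_one, dUp_word_zero_one]

theorem dUp_dUp_word_one_one (x y z : V) :
    dUp K V f g (dUp K V f g (word K V 1 1 ![x, y, z])) =
      iotaC K V (f (g x y) z - g x (f y z)) := by
  rw [dUp_word_one_one, map_sub, map_sub, dUp_word_zero_one, dUp_word_one_zero]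

theorem dUp_dUp_word_two_zero (x y z : V) :
    dUp K V f g (dUp K V f g (word K V 2 0 ![x, y, z])) =
      iotaC K V (g (g x y) z - g x (g y z)) := by
  rw [dUp_word_two_zero, map_sub, map_sub, dUp_word_one_zero, dUp_word_one_zero]

theorem iotaC_injective : Function.Injective (iotaC K V) := by
  rw [iotaC, LinearMap.coe_comp]
  exact (DirectSum.of_injective (β := fun p : ℕ × ℕ => TP K V (p.1 + 1 + p.2)) (0, 0)).comp
    (oneE K V).symm.injective

theorem word_mem_C3 (a b : ℕ) (h : a + 1 + b = 3) (v : Fin (a + 1 + b) → V) :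
    word K V a b v ∈ C3 K V :=
  Submodule.mem_iSup_of_mem (a, b) (Submodule.mem_iSup_of_mem h ⟨_, rfl⟩)

/-- A linear map vanishing on all words of length `3` vanishes on `C_3`. -/
theorem map_eq_zero_of_mem_C3 {M : Type*} [AddCommGroup M] [Module K M] (φ : TT K V →ₗ[K] M)
    (hφ : ∀ a b : ℕ, a + 1 + b = 3 → ∀ v : Fin (a + 1 + b) → V, φ (word K V a b v) = 0)
    {x : TT K V} (hx : x ∈ C3 K V) : φ x = 0 := by
  suffices h : C3 K V ≤ LinearMap.ker φ from h hx
  refine iSup₂_le fun p hp => ?_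
  rw [LinearMap.range_le_ker_iff]
  exact PiTensorProduct.ext (MultilinearMap.ext fun v => hφ p.1 p.2 hp v)


/-- For a vector space `A` with two bilinear operations
`ab := f a b` and `a ↗ b := g a b` and `d` the associated map on `C_*`: the three
formulas for `d ∘ d` on the words of length `3`, and the equivalence between the
vanishing of `d ∘ d` on `C_3` and the three defining relations of `P_↗`-algebras. -/
theorem dd_on_C3_up :
    (∀ v₁ v₂ v₃ : V,
      dUp K V f g (dUp K V f g
          (DirectSum.lof K (ℕ × ℕ) (fun q => TP K V (q.1 + 1 + q.2)) (0, 2)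
            (PiTensorProduct.tprod K ![v₁, v₂, v₃]))) =
        iotaC K V (f (f v₁ v₂) v₃ - f v₁ (f v₂ v₃)) ∧
      dUp K V f g (dUp K V f g
          (DirectSum.lof K (ℕ × ℕ) (fun q => TP K V (q.1 + 1 + q.2)) (1, 1)
            (PiTensorProduct.tprod K ![v₁, v₂, v₃]))) =
        iotaC K V (f (g v₁ v₂) v₃ - g v₁ (f v₂ v₃)) ∧
      dUp K V f g (dUp K V f g
          (DirectSum.lof K (ℕ × ℕ) (fun q => TP K V (q.1 + 1 + q.2)) (2, 0)
            (PiTensorProduct.tprod K ![v₁, v₂, v₃]))) =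
        iotaC K V (g (g v₁ v₂) v₃ - g v₁ (g v₂ v₃))) ∧
    ((∀ x ∈ C3 K V, dUp K V f g (dUp K V f g x) = 0) ↔
      ((∀ a b c : V, f (f a b) c = f a (f b c)) ∧
       (∀ a b c : V, f (g a b) c = g a (f b c)) ∧
       (∀ a b c : V, g (g a b) c = g a (g b c)))) := by
  refine ⟨fun x y z => ⟨dUp_dUp_word_zero_two K V f g x y z, dUp_dUp_word_one_one K V f g x y z,
    dUp_dUp_word_two_zero K V f g x y z⟩, fun h => ⟨fun a b c => ?_, fun a b c => ?_,
    fun a b c => ?_⟩, fun ⟨h₁, h₂, h₃⟩ x hx => ?_⟩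
  · have := h _ (word_mem_C3 K V 0 2 rfl ![a, b, c])
    rw [dUp_dUp_word_zero_two, map_eq_zero_iff _ (iotaC_injective K V)] at this
    exact sub_eq_zero.mp this
  · have := h _ (word_mem_C3 K V 1 1 rfl ![a, b, c])
    rw [dUp_dUp_word_one_one, map_eq_zero_iff _ (iotaC_injective K V)] at this
    exact sub_eq_zero.mp this
  · have := h _ (word_mem_C3 K V 2 0 rfl ![a, b, c])
    rw [dUp_dUp_word_two_zero, map_eq_zero_iff _ (iotaC_injective K V)] at this
    exact sub_eq_zero.mp this
  · refine map_eq_zero_of_mem_C3 K V (dUp K V f g ∘ₗ dUp K V f g) (fun a b hab v => ?_) hx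
    have hv : ∀ w : Fin 3 → V, w = ![w 0, w 1, w 2] := fun w => by
      ext i
      fin_cases i <;> rfl
    rw [LinearMap.comp_apply]
    obtain ⟨rfl, rfl⟩ | ⟨rfl, rfl⟩ | ⟨rfl, rfl⟩ :
        (a = 0 ∧ b = 2) ∨ (a = 1 ∧ b = 1) ∨ (a = 2 ∧ b = 0) := by omega
    · rw [hv v, dUp_dUp_word_zero_two, h₁, sub_self, map_zero]
    · rw [hv v, dUp_dUp_word_one_one, h₂, sub_self, map_zero]
    · rw [hv v, dUp_dUp_word_two_zero, h₃, sub_self, map_zero]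
end
end

section
/- Let A be a K-vector space with two bilinear operations (a,b) ↦ ab and (a,b) ↦ a ↘ b satisfying the three relations (ab)c = a(bc), (a↘b)c = a↘(bc) and (ab)↘c = a↘(b↘c) for all a, b, c ∈ A. Then the map d on C_* defined from these operations satisfies d∘d = 0, i.e. d(d(x)) = 0 for every x ∈ C_n and every n ≥ 1; thus (C_*, d) is a chain complex. -/
open scoped TensorProduct DirectSum

noncomputable section

variable (K : Type*) [Field K] (V : Type*) [AddCommGroup V] [Module K V]

variable (f g : V →ₗ[K] V →ₗ[K] V)

/-- The component on the summand of index `(a, b)` (word of length `n = a+1+b`, pointed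
at 1-indexed position `a+1`) of the differential of the complex computing the homology of
an algebra `(V, f, g)` with products `ab := f a b` and `a ↘ b := g a b`: the alternating
sum over the `n-1` pairs of adjacent letters of the contractions, the pair
`(v_a, v_{a+1})` (0-indexed), i.e. the pointed letter and its left neighbour, being
contracted by `↘` and all other pairs by the product `f`; the point stays on the merged
letter. -/
def dCompDown (a b : ℕ) : TP K V (a + 1 + b) →ₗ[K] TT K V :=
  ∑ p : Fin (a + 1 + b - 1),
    ((-1 : K) ^ (p : ℕ)) •
      (if hpa : (p : ℕ) < a then
        (DirectSum.lof K (ℕ × ℕ) (fun q => TP K V (q.1 + 1 + q.2)) (a - 1, b)) ∘ₗ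
          (castE K V (show a + 1 + b - 1 = (a - 1) + 1 + b by
            have := p.isLt; omega)).toLinearMap ∘ₗ
          mergeAt K V (if (p : ℕ) + 1 = a then g else f) (a + 1 + b) p
            (by have := p.isLt; omega)
      else
        (DirectSum.lof K (ℕ × ℕ) (fun q => TP K V (q.1 + 1 + q.2)) (a, b - 1)) ∘ₗ
          (castE K V (show a + 1 + b - 1 = a + 1 + (b - 1) by
            have := p.isLt; omega)).toLinearMap ∘ₗ
          mergeAt K V f (a + 1 + b) p (by have := p.isLt; omega))

/-- The differential `d` of the complex `C_*` associated with the algebra `(V, f, g)`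
with products `ab := f a b` and `a ↘ b := g a b`. -/
def dDown : TT K V →ₗ[K] TT K V :=
  DirectSum.toModule K (ℕ × ℕ) (TT K V) fun q => dCompDown K V f g q.1 q.2
/-- The elementary tensor `w 0 ⊗ ⋯ ⊗ w (n - 1)` made of the first letters of a sequence. -/
def wordTensor (n : ℕ) (w : ℕ → V) : TP K V n :=
  PiTensorProduct.tprod K fun i : Fin n => w i

lemma tprod_eq_wordTensor {n : ℕ} (v : Fin n → V) :
    PiTensorProduct.tprod K v =
      wordTensor K V n (fun i => if h : i < n then v ⟨i, h⟩ else 0) := by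
  simp [wordTensor]

lemma wordTensor_congr {n : ℕ} {w w' : ℕ → V} (h : ∀ i < n, w i = w' i) :
    wordTensor K V n w = wordTensor K V n w' := by
  unfold wordTensor
  congr 1
  funext i
  exact h i i.isLt

@[simp]
lemma castE_wordTensor {a b : ℕ} (h : a = b) (w : ℕ → V) :
    castE K V h (wordTensor K V a w) = wordTensor K V b w := by
  subst h
  simp [castE, wordTensor]

lemma mulE_wordTensor (a b : ℕ) (w : ℕ → V) :
    mulE K V a b (wordTensor K V a w ⊗ₜ wordTensor K V b (fun i => w (a + i))) =
      wordTensor K V (a + b) w := by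
  unfold mulE wordTensor
  rw [LinearEquiv.trans_apply, PiTensorProduct.tmulEquiv_apply, PiTensorProduct.reindex_tprod]
  congr 1
  funext i
  refine Fin.addCases (fun j => ?_) (fun j => ?_) i <;> simp

@[simp]
lemma mulE_symm_wordTensor (a b : ℕ) (w : ℕ → V) :
    (mulE K V a b).symm (wordTensor K V (a + b) w) =
      wordTensor K V a w ⊗ₜ wordTensor K V b (fun i => w (a + i)) := by
  rw [LinearEquiv.symm_apply_eq, mulE_wordTensor]

@[simp]
lemma oneE_wordTensor (w : ℕ → V) : oneE K V (wordTensor K V 1 w) = w 0 := by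
  simp [oneE, wordTensor]

lemma oneE_symm_eq_wordTensor (w : ℕ → V) :
    (oneE K V).symm (w 0) = wordTensor K V 1 w := by
  rw [LinearEquiv.symm_apply_eq, oneE_wordTensor]

lemma f2_wordTensor (w : ℕ → V) : f2 K V f (wordTensor K V 2 w) = f (w 0) (w 1) := by
  have h := mulE_symm_wordTensor K V 1 1 w
  simp only [f2, LinearMap.comp_apply, LinearEquiv.coe_coe, castE_wordTensor]
  rw [h]
  simp

/-- The sequence obtained from `w` by contracting the letters `w p` and `w (p + 1)`
by means of `f`. -/
def mergeWord (p : ℕ) (w : ℕ → V) (i : ℕ) : V :=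
  if i < p then w i else if i = p then f (w p) (w (p + 1)) else w (i + 1)

lemma mergeCore_wordTensor (p q : ℕ) (w : ℕ → V) :
    mergeCore K V f p q (wordTensor K V (p + (2 + q)) w) =
      wordTensor K V (p + (1 + q)) (mergeWord K V f p w) := by
  have hone : (oneE K V).symm (f (w p) (w (p + 1))) =
      wordTensor K V 1 (fun i => mergeWord K V f p w (p + i)) := by
    rw [← oneE_symm_eq_wordTensor]
    simp [mergeWord]
  have hq : wordTensor K V q (fun i => w (p + (2 + i))) =
      wordTensor K V q (fun i => mergeWord K V f p w (p + (1 + i))) := by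
    refine wordTensor_congr K V fun i _ => ?_
    rw [mergeWord, if_neg (by omega), if_neg (by omega)]
    congr 1
    omega
  have hp : wordTensor K V p w = wordTensor K V p (mergeWord K V f p w) :=
    wordTensor_congr K V fun i hi => by rw [mergeWord, if_pos hi]
  simp only [mergeCore, LinearMap.comp_apply, LinearEquiv.coe_coe, mulE_symm_wordTensor,
    TensorProduct.map_tmul, f2_wordTensor, LinearMap.id_apply, add_zero]
  rw [hone, hq, hp, mulE_wordTensor K V 1 q (fun i => mergeWord K V f p w (p + i)),
    mulE_wordTensor]

lemma mergeAt_wordTensor (n p : ℕ) (h : p + 2 ≤ n) (w : ℕ → V) :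
    mergeAt K V f n p h (wordTensor K V n w) =
      wordTensor K V (n - 1) (mergeWord K V f p w) := by
  simp [mergeAt, mergeCore_wordTensor]

lemma mergeWord_mergeWord_of_lt {p q : ℕ} (hpq : p < q) (w : ℕ → V) :
    mergeWord K V f q (mergeWord K V g p w) =
      mergeWord K V g p (mergeWord K V f (q + 1) w) := by
  funext i
  unfold mergeWord
  grind

lemma mergeWord_mergeWord_self {f g f' g' : V →ₗ[K] V →ₗ[K] V}
    (h : ∀ a b c, f (g a b) c = f' a (g' b c)) (p : ℕ) (w : ℕ → V) :
    mergeWord K V f p (mergeWord K V g p w) =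
      mergeWord K V f' p (mergeWord K V g' (p + 1) w) := by
  funext i
  unfold mergeWord
  grind

/-- The pointed word with letters `w 0, …, w (a + b)`, pointed at `w a`. -/
def pointedWord (a b : ℕ) (w : ℕ → V) : TT K V :=
  DirectSum.lof K (ℕ × ℕ) (fun q => TP K V (q.1 + 1 + q.2)) (a, b)
    (wordTensor K V (a + 1 + b) w)

/-- The operation contracting the letters at positions `p` and `p + 1` of a word pointed at
position `a`. -/
def contraction (a p : ℕ) : V →ₗ[K] V →ₗ[K] V :=
  if p + 1 = a then g else f

/-- The face of a pointed word contracting the letters at positions `p` and `p + 1`. -/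
def face (p a b : ℕ) (w : ℕ → V) : TT K V :=
  pointedWord K V (if p < a then a - 1 else a) (if p < a then b else b - 1)
    (mergeWord K V (contraction K V f g a p) p w)

lemma dDown_pointedWord (a b : ℕ) (w : ℕ → V) :
    dDown K V f g (pointedWord K V a b w) =
      ∑ p ∈ Finset.range (a + b), (-1 : K) ^ p • face K V f g p a b w := by
  have hab : a + b = a + 1 + b - 1 := by omega
  rw [pointedWord, dDown, DirectSum.toModule_lof, hab, ← Fin.sum_univ_eq_sum_range
    (fun p => (-1 : K) ^ p • face K V f g p a b w), dCompDown, LinearMap.sum_apply]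
  refine Finset.sum_congr rfl fun p _ => ?_
  rw [LinearMap.smul_apply]
  congr 1
  by_cases hp : (p : ℕ) < a
  · rw [face, if_pos hp, if_pos hp]
    simp [hp, pointedWord, contraction, mergeAt_wordTensor]
  · have hp' : (p : ℕ) + 1 ≠ a := by omega
    rw [face, if_neg hp, if_neg hp]
    simp [hp, hp', pointedWord, contraction, mergeAt_wordTensor]

/-- The iterated face contracting at `p`, then at `q`. -/
def faceFace (p q a b : ℕ) (w : ℕ → V) : TT K V :=
  face K V f g q (if p < a then a - 1 else a) (if p < a then b else b - 1)
    (mergeWord K V (contraction K V f g a p) p w)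

lemma faceFace_comm
    (h₁ : ∀ a b c : V, f (f a b) c = f a (f b c))
    (h₂ : ∀ a b c : V, f (g a b) c = g a (f b c))
    (h₃ : ∀ a b c : V, g (f a b) c = g a (g b c))
    {p q : ℕ} (hpq : p ≤ q) (a b : ℕ) (w : ℕ → V) :
    faceFace K V f g p q a b w = faceFace K V f g (q + 1) p a b w := by
  unfold faceFace face
  congr 1
  · split_ifs <;> omega
  · split_ifs <;> omega
  · rcases hpq.lt_or_eq with hlt | rfl
    · rw [mergeWord_mergeWord_of_lt K V _ _ hlt]
      have e₁ : contraction K V f g a p =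
          contraction K V f g (if q + 1 < a then a - 1 else a) p := by
        unfold contraction
        congr 1
        split_ifs <;> apply propext <;> omega
      have e₂ : contraction K V f g (if p < a then a - 1 else a) q =
          contraction K V f g a (q + 1) := by
        unfold contraction
        congr 1
        split_ifs <;> apply propext <;> omega
      rw [e₁, e₂]
    · refine mergeWord_mergeWord_self K V (fun x y z => ?_) p w
      unfold contraction
      grind

lemma sum_sum_alternating_eq_zero {M : Type*} [AddCommGroup M] [Module K M] (m : ℕ)
    (F : ℕ → ℕ → M) (hF : ∀ p q, p ≤ q → q < m → F p q = F (q + 1) p) :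
    ∑ p ∈ Finset.range (m + 1), ∑ q ∈ Finset.range m, (-1 : K) ^ (p + q) • F p q = 0 := by
  rw [← Finset.sum_product']
  refine Finset.sum_involution
    (fun x _ => if x.1 ≤ x.2 then (x.2 + 1, x.1) else (x.2, x.1 - 1)) ?_ ?_ ?_ ?_
  · rintro ⟨p, q⟩ hx
    simp only [Finset.mem_product, Finset.mem_range] at hx
    by_cases hpq : p ≤ q
    · simp only [hpq, if_true]
      rw [hF p q hpq hx.2, ← add_smul, show q + 1 + p = p + q + 1 by omega, pow_succ]
      simp
    · obtain ⟨r, rfl⟩ : ∃ r, p = r + 1 := ⟨p - 1, by omega⟩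
      simp only [hpq, if_false, Nat.add_sub_cancel]
      rw [hF q r (by omega) (by omega), ← add_smul, show r + 1 + q = q + r + 1 by omega,
        pow_succ]
      simp
  · rintro ⟨p, q⟩ _ _ h
    simp only at h
    split_ifs at h <;> simp only [Prod.mk.injEq] at h <;> omega
  · rintro ⟨p, q⟩ hx
    simp only [Finset.mem_product, Finset.mem_range] at hx ⊢
    split_ifs <;> simp only <;> omega
  · rintro ⟨p, q⟩ _
    grind

lemma dDown_dDown_pointedWord
    (h₁ : ∀ a b c : V, f (f a b) c = f a (f b c))
    (h₂ : ∀ a b c : V, f (g a b) c = g a (f b c))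
    (h₃ : ∀ a b c : V, g (f a b) c = g a (g b c)) (a b : ℕ) (w : ℕ → V) :
    dDown K V f g (dDown K V f g (pointedWord K V a b w)) = 0 := by
  rw [dDown_pointedWord, map_sum]
  rcases hm : a + b with _ | m
  · simp
  rw [← sum_sum_alternating_eq_zero K m (fun p q => faceFace K V f g p q a b w)
    fun p q hpq _ => faceFace_comm K V f g h₁ h₂ h₃ hpq a b w]
  refine Finset.sum_congr rfl fun p hp => ?_
  rw [Finset.mem_range] at hp
  have hlen : (if p < a then a - 1 else a) + (if p < a then b else b - 1) = m := by
    split_ifs <;> omega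
  rw [map_smul, face, dDown_pointedWord, hlen, Finset.smul_sum]
  refine Finset.sum_congr rfl fun q _ => ?_
  rw [smul_smul, ← pow_add, faceFace]

/-- If the two bilinear operations `ab := f a b` and `a ↘ b := g a b` on
the vector space `A` satisfy the three defining relations of `P_↘`-algebras, then the
associated map `d` on `C_*` satisfies `d ∘ d = 0`: `(C_*, d)` is a chain complex. -/
theorem dd_eq_zero_down
    (h₁ : ∀ a b c : V, f (f a b) c = f a (f b c))
    (h₂ : ∀ a b c : V, f (g a b) c = g a (f b c))
    (h₃ : ∀ a b c : V, g (f a b) c = g a (g b c)) :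
    ∀ x : TT K V, dDown K V f g (dDown K V f g x) = 0 := by
  intro x
  suffices h : dDown K V f g ∘ₗ dDown K V f g = 0 from LinearMap.congr_fun h x
  refine DirectSum.linearMap_ext K fun ⟨a, b⟩ => PiTensorProduct.ext ?_
  refine MultilinearMap.ext fun v => ?_
  simp only [LinearMap.compMultilinearMap_apply, LinearMap.comp_apply, LinearMap.zero_apply,
    tprod_eq_wordTensor K V v]
  exact dDown_dDown_pointedWord K V f g h₁ h₂ h₃ a b _
end
end

section
/- Every D-decorated planar forest F ∈ F^D can be written uniquely as F = F_1 ↗ F_2 ↗ … ↗ F_n (n ≥ 1), where each F_i is a D-decorated planar forest whose first tree is a single vertex, i.e. F_i = •_{d_i} G_i with d_i ∈ D and G_i a (possibly empty) list of D-decorated planar rooted trees. (Here ↗ is the left grafting on the leftmost leaf, which is associative, so the iterated product is unambiguous.) Consequently, the algebra (A^D, ↗) is the free non-unital associative algebra on the set of forests whose first tree is a single vertex. -/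
noncomputable section

/-- A planar rooted tree decorated by `D`: a root decorated by an element of `D` together
with a (possibly empty) ordered list of planar subtrees. -/
inductive PTree (D : Type) : Type
  | node : D → List (PTree D) → PTree D

/-- A nonempty planar forest decorated by `D`: a nonempty ordered list of `D`-decorated
planar rooted trees, given by its first tree and the list of the remaining ones. -/
structure PForest (D : Type) : Type where
  head : PTree D
  tail : List (PTree D)

namespace PForest

variable {D : Type}

/-- The underlying list of trees of a forest. -/
def toList (F : PForest D) : List (PTree D) := F.head :: F.tail

/-- Concatenation `F · G` of two forests. -/
def concat (F G : PForest D) : PForest D := ⟨F.head, F.tail ++ G.toList⟩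

/-- Left grafting on the root: for `G = B_d(t₁ … t_m) G'`,
`F ↘ G = B_d(F t₁ … t_m) G'`. -/
def graftRoot (F G : PForest D) : PForest D :=
  match G with
  | ⟨.node d ts, G'⟩ => ⟨.node d (F.toList ++ ts), G'⟩

/-- Left grafting of a forest on the leftmost leaf of a tree. -/
def graftLeafT (L : List (PTree D)) : PTree D → PTree D
  | .node d [] => .node d L
  | .node d (h :: hs) => .node d (graftLeafT L h :: hs)

/-- Left grafting on the leftmost leaf: for `G = B_d(H) G'`, `F ↗ G = B_d(F) G'` if `H`
is empty, and `F ↗ G = B_d(F ↗ H) G'` otherwise. -/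
def graftLeaf (F G : PForest D) : PForest D := ⟨graftLeafT F.toList G.head, G.tail⟩

/-- The single-vertex tree `•_d`, as a forest. -/
def vertex (d : D) : PForest D := ⟨.node d [], []⟩

end PForest

variable (K : Type*) [Field K] (D : Type)

/-- The planar forest algebra `A^D`: the vector space with basis the set of nonempty
`D`-decorated planar forests. -/
abbrev FA : Type _ := PForest D →₀ K

/-- The bilinear extension to `A^D` of a binary operation on forests. -/
def bil (op : PForest D → PForest D → PForest D) : FA K D →ₗ[K] FA K D →ₗ[K] FA K D :=
  Finsupp.lsum K fun F =>
    LinearMap.toSpanSingleton K (FA K D →ₗ[K] FA K D)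
      (Finsupp.lsum K fun G =>
        LinearMap.toSpanSingleton K (FA K D) (Finsupp.single (op F G) (1 : K)))
universe u

/-- A forest whose first tree is a single vertex `•_d`. -/
def PForest.vertexHeaded {D : Type} (F : PForest D) : Prop :=
  ∃ d : D, F.head = PTree.node d []

namespace PForest

theorem graftLeafT_graftLeaf {D : Type} (F G : PForest D) : ∀ t : PTree D,
    graftLeafT (F.graftLeaf G).toList t = graftLeafT F.toList (graftLeafT G.toList t)
  | .node d [] => by simp [graftLeafT, graftLeaf, toList]
  | .node d (h :: hs) => by
      simp only [graftLeafT]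
      rw [graftLeafT_graftLeaf F G h]

theorem graftLeaf_assoc {D : Type} (F G H : PForest D) :
    (F.graftLeaf G).graftLeaf H = F.graftLeaf (G.graftLeaf H) := by
  simp only [graftLeaf, mk.injEq, and_true]
  exact graftLeafT_graftLeaf F G H.head

theorem vertexHeaded_mk {D : Type} (d : D) (L : List (PTree D)) :
    vertexHeaded ⟨.node d [], L⟩ := ⟨d, rfl⟩

/-- Induction on forests by left grafting onto vertex-headed forests. -/
theorem graftLeaf_induction {D : Type} {P : PForest D → Prop}
    (of_vertexHeaded : ∀ V, V.vertexHeaded → P V)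
    (graft : ∀ F V, V.vertexHeaded → P F → P (F.graftLeaf V)) (F : PForest D) : P F :=
  aux F.head F.tail
where
  aux : ∀ (t : PTree D) (L : List (PTree D)), P ⟨t, L⟩
    | .node d [], L => of_vertexHeaded _ (vertexHeaded_mk d L)
    | .node d (h :: hs), L =>
        graft ⟨h, hs⟩ ⟨.node d [], L⟩ (vertexHeaded_mk d L) (aux h hs)

theorem not_vertexHeaded_graftLeaf {D : Type} (F : PForest D) {V : PForest D}
    (hV : V.vertexHeaded) : ¬ (F.graftLeaf V).vertexHeaded := by
  obtain ⟨d, hd⟩ := hV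
  rintro ⟨e, he⟩
  simp [graftLeaf, hd, graftLeafT, toList] at he

theorem graftLeaf_inj_of_vertexHeaded {D : Type} {F G V W : PForest D}
    (hV : V.vertexHeaded) (hW : W.vertexHeaded) (h : F.graftLeaf V = G.graftLeaf W) :
    F = G ∧ V = W := by
  obtain ⟨Vh, Vt⟩ := V
  obtain ⟨Wh, Wt⟩ := W
  obtain ⟨d, rfl : Vh = _⟩ := hV
  obtain ⟨e, rfl : Wh = _⟩ := hW
  obtain ⟨Fh, Ft⟩ := F
  obtain ⟨Gh, Gt⟩ := G
  simp_all [graftLeaf, graftLeafT, toList]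

theorem existsUnique_foldl_graftLeaf {D : Type} (F : PForest D) :
    ∃! p : PForest D × List (PForest D),
      (p.1.vertexHeaded ∧ ∀ Fi ∈ p.2, Fi.vertexHeaded) ∧ p.2.foldl graftLeaf p.1 = F := by
  induction F using graftLeaf_induction with
  | of_vertexHeaded V hV =>
    refine ⟨(V, []), ⟨⟨hV, by simp⟩, rfl⟩, ?_⟩
    rintro ⟨G, l⟩ ⟨⟨_, hl⟩, h⟩
    rcases List.eq_nil_or_concat' l with rfl | ⟨l, W, rfl⟩
    · simpa using h
    · rw [List.foldl_concat] at h
      exact absurd (h ▸ hV) (not_vertexHeaded_graftLeaf _ (hl W (by simp)))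
  | graft F V hV ih =>
    obtain ⟨⟨G, l⟩, ⟨⟨hG, hl⟩, rfl⟩, huniq⟩ := ih
    refine ⟨(G, l ++ [V]), ⟨⟨hG, ?_⟩, List.foldl_concat ..⟩, ?_⟩
    · intro Fi hFi
      rcases List.mem_append.1 hFi with h | h
      · exact hl Fi h
      · exact List.mem_singleton.1 h ▸ hV
    · rintro ⟨G', l'⟩ ⟨⟨hG', hl'⟩, h⟩
      rcases List.eq_nil_or_concat' l' with rfl | ⟨l', W, rfl⟩
      · rw [List.foldl_nil] at h
        exact absurd (h ▸ hG') (not_vertexHeaded_graftLeaf _ hV)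
      · rw [List.foldl_concat] at h
        obtain ⟨hF, rfl⟩ := graftLeaf_inj_of_vertexHeaded (hl' W (by simp)) hV h
        have := huniq (G', l') ⟨⟨hG', fun Fi hFi => hl' Fi (by simp [hFi])⟩, hF⟩
        simp_all

/-- The extension to all forests of a map on vertex-headed forests, sending `↗` to the
product; the forest is given by its first tree and the list of the remaining ones. -/
def graftLeafLift {D : Type} {B : Type*} [Mul B]
    (φ : {F : PForest D // F.vertexHeaded} → B) : PTree D → List (PTree D) → B
  | .node d [], L => φ ⟨⟨.node d [], L⟩, vertexHeaded_mk d L⟩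
  | .node d (h :: hs), L =>
      graftLeafLift φ h hs * φ ⟨⟨.node d [], L⟩, vertexHeaded_mk d L⟩

theorem graftLeafLift_of_vertexHeaded {D : Type} {B : Type*} [Mul B]
    (φ : {F : PForest D // F.vertexHeaded} → B) (V : {F : PForest D // F.vertexHeaded}) :
    graftLeafLift φ V.1.head V.1.tail = φ V := by
  obtain ⟨⟨t, L⟩, d, rfl : t = _⟩ := V
  simp [graftLeafLift]

theorem graftLeafLift_graftLeaf {D : Type} {B : Type*} [Semigroup B]
    (φ : {F : PForest D // F.vertexHeaded} → B) (F G : PForest D) :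
    graftLeafLift φ (F.graftLeaf G).head (F.graftLeaf G).tail =
      graftLeafLift φ F.head F.tail * graftLeafLift φ G.head G.tail := by
  have of_vertexHeaded (F V : PForest D) (hV : V.vertexHeaded) :
      graftLeafLift φ (F.graftLeaf V).head (F.graftLeaf V).tail =
        graftLeafLift φ F.head F.tail * graftLeafLift φ V.head V.tail := by
    obtain ⟨t, L⟩ := V
    obtain ⟨d, rfl : t = _⟩ := hV
    simp [graftLeaf, graftLeafT, toList, graftLeafLift]
  induction G using graftLeaf_induction with
  | of_vertexHeaded V hV => exact of_vertexHeaded F V hV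
  | graft G V hV ih =>
    rw [← graftLeaf_assoc, of_vertexHeaded _ V hV, ih, of_vertexHeaded G V hV, mul_assoc]

end PForest

theorem bil_single_single (K : Type*) [Field K] {D : Type}
    (op : PForest D → PForest D → PForest D) (F G : PForest D) (a b : K) :
    bil K D op (Finsupp.single F a) (Finsupp.single G b) =
      Finsupp.single (op F G) (a * b) := by
  simp [bil]

/-- Every `D`-decorated planar forest `F` can be written uniquely as
`F = F₁ ↗ F₂ ↗ ⋯ ↗ Fₙ` (`n ≥ 1`, the products being unambiguous since `↗` is
associative; here they are taken from left to right), where each `Fᵢ` is a forest whose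
first tree is a single vertex.  Consequently, `(A^D, ↗)` is the free non-unital
associative algebra on the set of forests whose first tree is a single vertex: any map
from this set to a non-unital associative `K`-algebra `B` extends uniquely to a linear
map `A^D → B` turning the product `↗` into the product of `B`. -/
theorem graftLeaf_unique_factorization [Fintype D] :
    (∀ F : PForest D, ∃! p : PForest D × List (PForest D),
      (p.1.vertexHeaded ∧ ∀ Fi ∈ p.2, Fi.vertexHeaded) ∧
        p.2.foldl PForest.graftLeaf p.1 = F) ∧
    (∀ (B : Type u) [NonUnitalSemiring B] [Module K B] [SMulCommClass K B B]
        [IsScalarTower K B B] (φ : {F : PForest D // F.vertexHeaded} → B),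
      ∃! ψ : FA K D →ₗ[K] B,
        (∀ g : {F : PForest D // F.vertexHeaded}, ψ (Finsupp.single g.1 (1 : K)) = φ g) ∧
        (∀ x y : FA K D, ψ (bil K D PForest.graftLeaf x y) = ψ x * ψ y)) := by
  refine ⟨PForest.existsUnique_foldl_graftLeaf, fun B _ _ _ _ φ => ?_⟩
  refine ⟨Finsupp.linearCombination K fun F => PForest.graftLeafLift φ F.head F.tail,
    ⟨fun g => ?_, fun x y => ?_⟩, ?_⟩
  · simpa using PForest.graftLeafLift_of_vertexHeaded φ g
  · induction x using Finsupp.induction_linear with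
    | zero => simp
    | add x₁ x₂ h₁ h₂ => simp only [map_add, LinearMap.add_apply, h₁, h₂, add_mul]
    | single F a =>
      induction y using Finsupp.induction_linear with
      | zero => simp
      | add y₁ y₂ h₁ h₂ => simp only [map_add, h₁, h₂, mul_add]
      | single G b =>
        simp only [bil_single_single, Finsupp.linearCombination_single,
          PForest.graftLeafLift_graftLeaf, smul_mul_smul_comm]
  · rintro ψ ⟨hφ, hmul⟩
    refine Finsupp.lhom_ext' fun F => LinearMap.ext_ring ?_
    simp only [LinearMap.comp_apply, Finsupp.lsingle_apply,
      Finsupp.linearCombination_single, one_smul]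
    induction F using PForest.graftLeaf_induction with
    | of_vertexHeaded V hV =>
      rw [hφ ⟨V, hV⟩, ← PForest.graftLeafLift_of_vertexHeaded φ ⟨V, hV⟩]
    | graft F V hV ih =>
      have h := hmul (Finsupp.single F 1) (Finsupp.single V 1)
      rw [bil_single_single, mul_one] at h
      rw [h, ih, hφ ⟨V, hV⟩, PForest.graftLeafLift_graftLeaf,
        ← PForest.graftLeafLift_of_vertexHeaded φ ⟨V, hV⟩]
end
end
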